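/- arXiv:1412.2284 — 6 statements merged into one kernel-verified Lean document; each statement's English description precedes it below -/
import Mathlib

section
/- Let k be a field and (m, ∘) a left pre-Lie algebra over k with commutator Lie bracket [ξ,η] := ξ∘η − η∘ξ. Suppose m additionally carries a (not necessarily unital) commutative associative bilinear product · such that [ξ, x·y] = [ξ,x]·y + x·[ξ,y] for all ξ, x, y ∈ m (i.e., (m, ·, [·,·]) is a not necessarily unital Poisson algebra). Then the bilinear product on m ⊕ m defined by (x,ξ) ~∘ (y,η) := (x·y + [ξ,y], ξ∘η) is left pre-Lie, i.e., it satisfies the left-symmetry identity. -/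
/-- Corollary 5.3 of the paper: let `(m, c)` be a left pre-Lie algebra with
commutator bracket `br ξ η := c ξ η - c η ξ`, and suppose `m` also carries a (not
necessarily unital) commutative associative product `mul` such that the commutator bracket
acts by derivations of `mul`.  Then `(x,ξ) ∘~ (y,η) := (mul x y + br ξ y, c ξ η)` is a
left pre-Lie product on `m ⊕ m`. -/
theorem poisson_pre_lie_semidirect
    (k m : Type*) [Field k] [AddCommGroup m] [Module k m]
    (c : m →ₗ[k] m →ₗ[k] m) (mul : m →ₗ[k] m →ₗ[k] m)
    (hc : ∀ a b x : m, c (c a b) x - c (c b a) x = c a (c b x) - c b (c a x))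
    (hcomm : ∀ x y : m, mul x y = mul y x)
    (hassoc : ∀ x y z : m, mul (mul x y) z = mul x (mul y z))
    (hleib : ∀ ξ x y : m,
      c ξ (mul x y) - c (mul x y) ξ
        = mul (c ξ x - c x ξ) y + mul x (c ξ y - c y ξ)) :
    let br : m → m → m := fun ξ η => c ξ η - c η ξ
    let p : m × m → m × m → m × m :=
      fun u v => (mul u.1 v.1 + br u.2 v.1, c u.2 v.2)
    ∀ u v w : m × m, p (p u v) w - p (p v u) w = p u (p v w) - p v (p u w) := by
  intro br p
  rintro ⟨x, a⟩ ⟨y, b⟩ ⟨z, e⟩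
  refine Prod.ext ?_ ?_
  · have h1 := hc a b z
    have h2 := hc b z a
    have h3 := hc z a b
    have l1 := hleib a y z
    have l2 := hleib b x z
    have e1 := hassoc x y z
    have e2 := hassoc y x z
    have e3 := hcomm x y
    simp only [p, br, Prod.fst_sub, map_add, map_sub, LinearMap.add_apply,
      LinearMap.sub_apply] at *
    rw [← e1, ← e2, e3]
    linear_combination (norm := skip) h1 + h2 + h3 - l1 + l2
    abel
  · simpa [p] using hc a b e
end

section
/- Let k be a field and V a k-vector space carrying: a Lie bracket [·,·]; a left pre-Lie product ∘ whose commutator bracket equals [·,·] (f∘h − h∘f = [f,h] for all f, h ∈ V); and a (not necessarily unital) commutative associative bilinear product ∗ such that [f, φ∗ψ] = [f,φ]∗ψ + φ∗[f,ψ] for all f, φ, ψ ∈ V (so (V, ∗, [·,·]) is a not necessarily unital Poisson algebra). Then the bilinear product on V ⊕ V defined by (φ,f) ~∘ (ψ,h) := (φ∗ψ + [f,ψ], f∘h) is left pre-Lie, and its commutator bracket is the semidirect sum Lie bracket [(φ,f),(ψ,h)] = ([f,ψ] − [h,φ], [f,h]). -/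
/-- Theorem 5.4 of the paper, algebraic content: let `V` be a Lie algebra
over `k` carrying a left pre-Lie product `c` whose commutator bracket is the Lie bracket,
and a (not necessarily unital) commutative associative product `star` of which the Lie
bracket acts by derivations.  Then `(φ,f) ∘~ (ψ,h) := (φ∗ψ + ⁅f,ψ⁆, c f h)` is a left
pre-Lie product on `V ⊕ V` whose commutator bracket is the semidirect sum Lie bracket
`[(φ,f),(ψ,h)] = (⁅f,ψ⁆ − ⁅h,φ⁆, ⁅f,h⁆)`. -/
theorem tangent_bundle_pre_lie
    (k V : Type*) [Field k] [LieRing V] [LieAlgebra k V]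
    (c : V →ₗ[k] V →ₗ[k] V) (star : V →ₗ[k] V →ₗ[k] V)
    (hc : ∀ a b x : V, c (c a b) x - c (c b a) x = c a (c b x) - c b (c a x))
    (hcbr : ∀ f h : V, c f h - c h f = ⁅f, h⁆)
    (hcomm : ∀ φ ψ : V, star φ ψ = star ψ φ)
    (hassoc : ∀ φ ψ ζ : V, star (star φ ψ) ζ = star φ (star ψ ζ))
    (hleib : ∀ f φ ψ : V, ⁅f, star φ ψ⁆ = star ⁅f, φ⁆ ψ + star φ ⁅f, ψ⁆) :
    let p : V × V → V × V → V × V :=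
      fun u v => (star u.1 v.1 + ⁅u.2, v.1⁆, c u.2 v.2)
    (∀ u v w : V × V, p (p u v) w - p (p v u) w = p u (p v w) - p v (p u w)) ∧
    (∀ (φ f ψ h : V),
      p (φ, f) (ψ, h) - p (ψ, h) (φ, f) = (⁅f, ψ⁆ - ⁅h, φ⁆, ⁅f, h⁆)) := by
  intro p
  refine ⟨?_, ?_⟩
  · rintro ⟨φ, f⟩ ⟨ψ, h⟩ ⟨ζ, g⟩
    have h1 : star φ (star ψ ζ) = star ψ (star φ ζ) := by
      rw [← hassoc, hcomm φ ψ, hassoc]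
    have h2 : ⁅c f h, ζ⁆ - ⁅c h f, ζ⁆ = ⁅f, ⁅h, ζ⁆⁆ - ⁅h, ⁅f, ζ⁆⁆ := by
      rw [← sub_lie, hcbr, lie_lie]
    have h3 := sub_eq_iff_eq_add.mp h2
    refine Prod.ext ?_ ?_
    · simp only [p, Prod.fst_sub, map_add, LinearMap.add_apply, lie_add, hleib, hassoc, h1, h3]
      abel
    · exact hc f h g
  · intro φ f ψ h
    refine Prod.ext ?_ ?_
    · simp only [p, Prod.fst_sub, hcomm ψ φ]
      abel
    · exact hcbr f h
end

section
/- Let k be a field and g a Lie algebra over k with dual space g* = Hom_k(g, k). Suppose: Ξ and ∘ are left pre-Lie products on g* with the same commutator bracket, i.e., Ξ(φ,ψ) − Ξ(ψ,φ) = φ∘ψ − ψ∘φ for all φ, ψ ∈ g*; ▷ : g* × g → g is a bilinear map satisfying ψ(φ▷x) = −Ξ(φ,ψ)(x) for all φ, ψ ∈ g*, x ∈ g; Ξ satisfies (Xi-ass): Ξ(φ,ψ)([x,y]) = Ξ(φ, ψ∘(ad x))(y) − Ξ(φ, ψ∘(ad y))(x) for all x, y ∈ g, φ, ψ ∈ g*,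 where (ψ∘(ad x))(z) := ψ([x,z]); Ξ satisfies (Xi-con): Ξ(φ∘(ad y), ψ)(x) = −Ξ(ψ∘(ad x), φ)(y) for all x, y ∈ g, φ, ψ ∈ g*; and g carries a left pre-Lie product ∗ such that φ▷(x∗y) = (φ▷x)∗y + x∗(φ▷y) for all φ ∈ g*, x, y ∈ g. Then the bilinear product on g ⊕ g* defined by (x,φ) ~∘ (y,ψ) := (x∗y + φ▷y, φ∘ψ) is left pre-Lie, i.e., it satisfies the left-symmetry identity. -/
/-- Theorem 6.3 of the paper, algebraic content: let `g` be a Lie algebra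
over `k` with dual `g* = Module.Dual k g`.  Suppose `Ξ` and `c` are left pre-Lie products
on `g*` with the same commutator bracket, `act : g* × g → g` is bilinear with
`ψ (act φ x) = -Ξ φ ψ x`, `Ξ` satisfies the (dualised) conditions (Xi-ass) and (Xi-con),
and `g` carries a left pre-Lie product `mulg` of which every `act φ` is a derivation.
Then `(x,φ) ∘~ (y,ψ) := (mulg x y + act φ y, c φ ψ)` is left pre-Lie on `g ⊕ g*`. -/
theorem cotangent_pre_lie
    (k g : Type*) [Field k] [LieRing g] [LieAlgebra k g]
    (Ξ c : Module.Dual k g →ₗ[k] Module.Dual k g →ₗ[k] Module.Dual k g)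
    (act : Module.Dual k g →ₗ[k] g →ₗ[k] g)
    (mulg : g →ₗ[k] g →ₗ[k] g)
    (hΞ : ∀ φ ψ ζ : Module.Dual k g,
      Ξ (Ξ φ ψ) ζ - Ξ (Ξ ψ φ) ζ = Ξ φ (Ξ ψ ζ) - Ξ ψ (Ξ φ ζ))
    (hc : ∀ φ ψ ζ : Module.Dual k g,
      c (c φ ψ) ζ - c (c ψ φ) ζ = c φ (c ψ ζ) - c ψ (c φ ζ))
    (hsame : ∀ φ ψ : Module.Dual k g, Ξ φ ψ - Ξ ψ φ = c φ ψ - c ψ φ)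
    (hact : ∀ (φ ψ : Module.Dual k g) (x : g), ψ (act φ x) = - Ξ φ ψ x)
    (hass : ∀ (x y : g) (φ ψ : Module.Dual k g),
      Ξ φ ψ ⁅x, y⁆
        = Ξ φ (ψ ∘ₗ (LieAlgebra.ad k g x)) y - Ξ φ (ψ ∘ₗ (LieAlgebra.ad k g y)) x)
    (hcon : ∀ (x y : g) (φ ψ : Module.Dual k g),
      Ξ (φ ∘ₗ (LieAlgebra.ad k g y)) ψ x = - Ξ (ψ ∘ₗ (LieAlgebra.ad k g x)) φ y)
    (hmul : ∀ x y z : g,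
      mulg (mulg x y) z - mulg (mulg y x) z = mulg x (mulg y z) - mulg y (mulg x z))
    (hder : ∀ (φ : Module.Dual k g) (x y : g),
      act φ (mulg x y) = mulg (act φ x) y + mulg x (act φ y)) :
    let p : g × Module.Dual k g → g × Module.Dual k g → g × Module.Dual k g :=
      fun u v => (mulg u.1 v.1 + act u.2 v.1, c u.2 v.2)
    ∀ u v w : g × Module.Dual k g,
      p (p u v) w - p (p v u) w = p u (p v w) - p v (p u w) := by
  have hrep : ∀ (φ ψ : Module.Dual k g) (z : g),
      act (c φ ψ) z - act (c ψ φ) z = act φ (act ψ z) - act ψ (act φ z) := by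
    intro φ ψ z
    have e : act (c φ ψ) z - act (c ψ φ) z = act (Ξ φ ψ - Ξ ψ φ) z := by
      rw [hsame, map_sub, LinearMap.sub_apply]
    rw [e, ← sub_eq_zero, ← Module.forall_dual_apply_eq_zero_iff k]
    intro ζ
    have h := congrArg (fun f : Module.Dual k g => f z) (hΞ φ ψ ζ)
    simp only [LinearMap.sub_apply] at h
    simp only [map_sub, LinearMap.sub_apply, hact, neg_neg]
    linear_combination -h
  intro p u v w
  obtain ⟨x, φ⟩ := u
  obtain ⟨y, ψ⟩ := v
  obtain ⟨z, ζ⟩ := w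
  refine Prod.ext ?_ (hc φ ψ ζ)
  have h1 := hmul x y z
  have h2 := hrep φ ψ z
  simp only [p, Prod.fst_sub, map_add, LinearMap.add_apply, hder]
  rw [sub_eq_iff_eq_add] at h1 h2
  rw [h1, h2]
  abel
end

section
/- Let k be a field and g a Lie algebra over k with dual space g* = Hom_k(g, k). Suppose Ξ is a left pre-Lie product on g* satisfying (Xi-ass): Ξ(φ,ψ)([x,y]) = Ξ(φ, ψ∘(ad x))(y) − Ξ(φ, ψ∘(ad y))(x) and (Xi-con): Ξ(φ∘(ad y), ψ)(x) = −Ξ(ψ∘(ad x), φ)(y) for all x, y ∈ g, φ, ψ ∈ g*; suppose ▷ : g* × g → g is a bilinear map with ψ(φ▷x) = −Ξ(φ,ψ)(x) for all φ, ψ, x; and suppose ∗ is a left pre-Lie product on g such that φ▷(x∗y) = (φ▷x)∗y + x∗(φ▷y) for all φ ∈ g*, x, y ∈ g. Then the bilinear product on g ⊕ g* defined by (x,φ) ~∘ (y,ψ) := (x∗y + φ▷y, Ξ(φ,ψ)) is left pre-Lie, i.e., it satisfies the left-symmetry identity. -/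
/-- first assertion of Corollary 6.5 of the paper: the special case of the
cotangent-bundle pre-Lie construction in which the two pre-Lie structures on `g*`
coincide: if `Ξ` is a left pre-Lie product on `g* = Module.Dual k g` satisfying (Xi-ass)
and (Xi-con), `act : g* × g → g` is bilinear with `ψ (act φ x) = -Ξ φ ψ x`, and `mulg` is
a left pre-Lie product on `g` of which every `act φ` is a derivation, then
`(x,φ) ∘~ (y,ψ) := (mulg x y + act φ y, Ξ φ ψ)` is left pre-Lie on `g ⊕ g*`. -/
theorem cotangent_pre_lie_special
    (k g : Type*) [Field k] [LieRing g] [LieAlgebra k g]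
    (Ξ : Module.Dual k g →ₗ[k] Module.Dual k g →ₗ[k] Module.Dual k g)
    (act : Module.Dual k g →ₗ[k] g →ₗ[k] g)
    (mulg : g →ₗ[k] g →ₗ[k] g)
    (hΞ : ∀ φ ψ ζ : Module.Dual k g,
      Ξ (Ξ φ ψ) ζ - Ξ (Ξ ψ φ) ζ = Ξ φ (Ξ ψ ζ) - Ξ ψ (Ξ φ ζ))
    (hass : ∀ (x y : g) (φ ψ : Module.Dual k g),
      Ξ φ ψ ⁅x, y⁆
        = Ξ φ (ψ ∘ₗ (LieAlgebra.ad k g x)) y - Ξ φ (ψ ∘ₗ (LieAlgebra.ad k g y)) x)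
    (hcon : ∀ (x y : g) (φ ψ : Module.Dual k g),
      Ξ (φ ∘ₗ (LieAlgebra.ad k g y)) ψ x = - Ξ (ψ ∘ₗ (LieAlgebra.ad k g x)) φ y)
    (hact : ∀ (φ ψ : Module.Dual k g) (x : g), ψ (act φ x) = - Ξ φ ψ x)
    (hmul : ∀ x y z : g,
      mulg (mulg x y) z - mulg (mulg y x) z = mulg x (mulg y z) - mulg y (mulg x z))
    (hder : ∀ (φ : Module.Dual k g) (x y : g),
      act φ (mulg x y) = mulg (act φ x) y + mulg x (act φ y)) :
    let p : g × Module.Dual k g → g × Module.Dual k g → g × Module.Dual k g :=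
      fun u v => (mulg u.1 v.1 + act u.2 v.1, Ξ u.2 v.2)
    ∀ u v w : g × Module.Dual k g,
      p (p u v) w - p (p v u) w = p u (p v w) - p v (p u w) := by
  have hrep : ∀ (φ ψ : Module.Dual k g) (x : g),
      act (Ξ φ ψ) x - act (Ξ ψ φ) x = act φ (act ψ x) - act ψ (act φ x) := by
    intro φ ψ x
    rw [← sub_eq_zero, ← Module.forall_dual_apply_eq_zero_iff k]
    intro ζ
    have h := LinearMap.congr_fun (hΞ φ ψ ζ) x
    simp only [LinearMap.sub_apply] at h
    simp only [map_sub, hact]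
    linear_combination -h
  intro p u v w
  obtain ⟨x, φ⟩ := u
  obtain ⟨y, ψ⟩ := v
  obtain ⟨z, ζ⟩ := w
  refine Prod.ext ?_ (hΞ φ ψ ζ)
  have h1 := hrep φ ψ z
  have h2 := hmul x y z
  simp only [p, Prod.fst_sub, map_add, LinearMap.add_apply, hder]
  rw [← sub_eq_zero] at h1 h2 ⊢
  rw [← add_zero (0 : g)]
  nth_rewrite 1 [← h1]
  rw [← h2]
  abel
end

section
/- Let k be a field, g a Lie algebra over k, and a_1,…,a_n, b_1,…,b_n ∈ g elements such that r = Σ_i a_i ⊗ b_i ∈ g ⊗ g satisfies the classical Yang–Baxter equation Σ_{i,j} ( [a_i,a_j] ⊗ b_i ⊗ b_j + a_i ⊗ [b_i,a_j] ⊗ b_j + a_i ⊗ a_j ⊗ [b_i,b_j] ) = 0 in g ⊗ g ⊗ g, and such that the symmetric part of r acts trivially: Σ_i ( a_i ⊗ [b_i,x] + b_i ⊗ [a_i,x] ) = 0 in g ⊗ g for every x ∈ g. Define Ξ : g* × g* → g* by Ξ(φ,ψ) := −Σ_i φ(b_i) · ad*_{a_i} ψ, where (ad*_a ψ)(z) :=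 −ψ([a,z]). Then (1) Ξ is left pre-Lie, i.e., Ξ(Ξ(φ,ψ),ζ) − Ξ(Ξ(ψ,φ),ζ) = Ξ(φ,Ξ(ψ,ζ)) − Ξ(ψ,Ξ(φ,ζ)) for all φ, ψ, ζ ∈ g*, and (2) its commutator bracket is given for all x ∈ g by (Ξ(φ,ψ) − Ξ(ψ,φ))(x) = Σ_i ( φ([x,a_i]) ψ(b_i) + φ(a_i) ψ([x,b_i]) ). -/
open TensorProduct

/-- Example 4.5 of the paper: let `g` be a Lie algebra over a field `k` and
`r = Σᵢ aᵢ ⊗ bᵢ ∈ g ⊗ g` a solution of the classical Yang–Baxter equation whose symmetric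
part acts trivially.  Then `Ξ(φ,ψ) := -Σᵢ φ(bᵢ) • ad*_{aᵢ} ψ` is a left pre-Lie product
on `g*` whose commutator bracket is given by
`(Ξ φ ψ - Ξ ψ φ)(x) = Σᵢ (φ⁅x,aᵢ⁆ ψ(bᵢ) + φ(aᵢ) ψ⁅x,bᵢ⁆)`. -/
theorem quasitriangular_pre_lie
    (k g : Type*) [Field k] [LieRing g] [LieAlgebra k g]
    (n : ℕ) (a b : Fin n → g)
    (hCYBE : ∑ i : Fin n, ∑ j : Fin n,
        ((⁅a i, a j⁆ ⊗ₜ[k] ((b i) ⊗ₜ[k] (b j)))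
          + ((a i) ⊗ₜ[k] (⁅b i, a j⁆ ⊗ₜ[k] (b j)))
          + ((a i) ⊗ₜ[k] ((a j) ⊗ₜ[k] ⁅b i, b j⁆)))
      = (0 : g ⊗[k] (g ⊗[k] g)))
    (hsym : ∀ x : g,
      ∑ i : Fin n, (((a i) ⊗ₜ[k] ⁅b i, x⁆) + ((b i) ⊗ₜ[k] ⁅a i, x⁆)) = (0 : g ⊗[k] g)) :
    let coad : g → Module.Dual k g → Module.Dual k g :=
      fun y ψ => - (ψ ∘ₗ (LieAlgebra.ad k g y))
    let Ξ : Module.Dual k g → Module.Dual k g → Module.Dual k g :=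
      fun φ ψ => - ∑ i : Fin n, φ (b i) • coad (a i) ψ
    (∀ φ ψ ζ : Module.Dual k g,
      Ξ (Ξ φ ψ) ζ - Ξ (Ξ ψ φ) ζ = Ξ φ (Ξ ψ ζ) - Ξ ψ (Ξ φ ζ)) ∧
    (∀ (x : g) (φ ψ : Module.Dual k g),
      (Ξ φ ψ - Ξ ψ φ) x
        = ∑ i : Fin n, (φ ⁅x, a i⁆ * ψ (b i) + φ (a i) * ψ ⁅x, b i⁆)) := by
  intro coad Ξ
  have hΞ : ∀ (φ ψ : Module.Dual k g) (x : g),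
      Ξ φ ψ x = ∑ i : Fin n, φ (b i) * ψ ⁅a i, x⁆ := by
    intro φ ψ x
    simp [Ξ, coad, LinearMap.sum_apply]
  have h2 : ∀ (x : g) (φ ψ : Module.Dual k g),
      (Ξ φ ψ - Ξ ψ φ) x
        = ∑ i : Fin n, (φ ⁅x, a i⁆ * ψ (b i) + φ (a i) * ψ ⁅x, b i⁆) := by
    intro x φ ψ
    have h := congrArg (LinearMap.mul' k k ∘ₗ TensorProduct.map φ ψ) (hsym x)
    simp only [map_sum, map_add, LinearMap.comp_apply, TensorProduct.map_tmul,
      LinearMap.mul'_apply, map_zero] at h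
    rw [LinearMap.sub_apply, hΞ, hΞ, ← Finset.sum_sub_distrib, ← sub_eq_zero,
      ← Finset.sum_sub_distrib, ← h]
    refine Finset.sum_congr rfl fun i _ => ?_
    rw [← lie_skew (a i) x, ← lie_skew (b i) x]
    simp only [map_neg]
    ring
  refine ⟨fun φ ψ ζ => ?_, h2⟩
  ext x
  have h := congrArg (LinearMap.mul' k k ∘ₗ TensorProduct.map
    (ζ ∘ₗ (-(LieAlgebra.ad k g x))) (LinearMap.mul' k k ∘ₗ TensorProduct.map φ ψ)) hCYBE
  simp only [map_sum, map_add, LinearMap.comp_apply, TensorProduct.map_tmul,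
    LinearMap.mul'_apply, map_zero, LinearMap.neg_apply, LieAlgebra.ad_apply, lie_skew] at h
  have hL : (Ξ (Ξ φ ψ) ζ - Ξ (Ξ ψ φ) ζ) x = ∑ i : Fin n, ∑ j : Fin n,
      (φ ⁅b i, a j⁆ * ψ (b j) + φ (a j) * ψ ⁅b i, b j⁆) * ζ ⁅a i, x⁆ := by
    rw [LinearMap.sub_apply, hΞ, hΞ, ← Finset.sum_sub_distrib]
    refine Finset.sum_congr rfl fun i _ => ?_
    rw [← sub_mul, ← LinearMap.sub_apply, h2, Finset.sum_mul]
  have hR : (Ξ φ (Ξ ψ ζ) - Ξ ψ (Ξ φ ζ)) x = ∑ i : Fin n, ∑ j : Fin n,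
      -(φ (b i) * ψ (b j) * ζ ⁅⁅a i, a j⁆, x⁆) := by
    rw [LinearMap.sub_apply, hΞ, hΞ]
    simp only [hΞ, Finset.mul_sum]
    rw [Finset.sum_comm (f := fun i j => ψ (b i) * (φ (b j) * ζ ⁅a j, ⁅a i, x⁆⁆)),
      ← Finset.sum_sub_distrib]
    refine Finset.sum_congr rfl fun i _ => ?_
    rw [← Finset.sum_sub_distrib]
    refine Finset.sum_congr rfl fun j _ => ?_
    rw [lie_lie, map_sub]
    ring
  rw [hL, hR, ← sub_eq_zero, ← Finset.sum_sub_distrib, ← h]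
  refine Finset.sum_congr rfl fun i _ => ?_
  rw [← Finset.sum_sub_distrib]
  refine Finset.sum_congr rfl fun j _ => ?_
  ring
end

section
/- Let k be a field, g a Lie algebra over k, and a_1,…,a_n, b_1,…,b_n ∈ g such that r = Σ_i a_i ⊗ b_i satisfies the classical Yang–Baxter equation Σ_{i,j} ( [a_i,a_j] ⊗ b_i ⊗ b_j + a_i ⊗ [b_i,a_j] ⊗ b_j + a_i ⊗ a_j ⊗ [b_i,b_j] ) = 0 in g ⊗ g ⊗ g and the condition Σ_i ( a_i ⊗ [b_i,x] + b_i ⊗ [a_i,x] ) = 0 in g ⊗ g for all x ∈ g. Define Ξ(φ,ψ) := −Σ_i φ(b_i) · ad*_{a_i} ψ on g*, where (ad*_a ψ)(z) := −ψ([a,z]). Then Ξ satisfies both (Xi-ass): Ξ(φ,ψ)([x,y]) = Ξ(φ, ψ∘(ad x))(y) − Ξ(φ, ψ∘(ad y))(x), and (Xi-con): Ξ(φ∘(ad y), ψ)(x) = −Ξ(ψ∘(ad x), φ)(y), for all x, y ∈ g and φ, ψ ∈ g*. -/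
open TensorProduct

/-- Example 6.2 of the paper, computational claim: for a quasitriangular
Lie bialgebra `(g, r)` with `r = Σᵢ aᵢ ⊗ bᵢ` satisfying the classical Yang–Baxter
equation and whose symmetric part acts trivially, the r-matrix pre-Lie product
`Ξ(φ,ψ) := -Σᵢ φ(bᵢ) • ad*_{aᵢ} ψ` on `g*` satisfies both the (dualised) conditions
(Xi-ass) and (Xi-con). -/
theorem quasitriangular_Xi_ass_con
    (k g : Type*) [Field k] [LieRing g] [LieAlgebra k g]
    (n : ℕ) (a b : Fin n → g)
    (hCYBE : ∑ i : Fin n, ∑ j : Fin n,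
        ((⁅a i, a j⁆ ⊗ₜ[k] ((b i) ⊗ₜ[k] (b j)))
          + ((a i) ⊗ₜ[k] (⁅b i, a j⁆ ⊗ₜ[k] (b j)))
          + ((a i) ⊗ₜ[k] ((a j) ⊗ₜ[k] ⁅b i, b j⁆)))
      = (0 : g ⊗[k] (g ⊗[k] g)))
    (hsym : ∀ x : g,
      ∑ i : Fin n, (((a i) ⊗ₜ[k] ⁅b i, x⁆) + ((b i) ⊗ₜ[k] ⁅a i, x⁆)) = (0 : g ⊗[k] g)) :
    let coad : g → Module.Dual k g → Module.Dual k g :=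
      fun y ψ => - (ψ ∘ₗ (LieAlgebra.ad k g y))
    let Ξ : Module.Dual k g → Module.Dual k g → Module.Dual k g :=
      fun φ ψ => - ∑ i : Fin n, φ (b i) • coad (a i) ψ
    (∀ (x y : g) (φ ψ : Module.Dual k g),
      Ξ φ ψ ⁅x, y⁆
        = Ξ φ (ψ ∘ₗ (LieAlgebra.ad k g x)) y - Ξ φ (ψ ∘ₗ (LieAlgebra.ad k g y)) x) ∧
    (∀ (x y : g) (φ ψ : Module.Dual k g),
      Ξ (φ ∘ₗ (LieAlgebra.ad k g y)) ψ x = - Ξ (ψ ∘ₗ (LieAlgebra.ad k g x)) φ y) := by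
  intro coad Ξ
  have key : ∀ (φ ψ : Module.Dual k g) (z : g),
      Ξ φ ψ z = ∑ i : Fin n, φ (b i) * ψ ⁅a i, z⁆ := by
    intro φ ψ z
    simp [Ξ, coad, LinearMap.sum_apply]
  refine ⟨?_, ?_⟩
  · intro x y φ ψ
    rw [key, key, key, ← Finset.sum_sub_distrib]
    refine Finset.sum_congr rfl fun i _ => ?_
    simp only [LinearMap.comp_apply, LieAlgebra.ad_apply]
    rw [← mul_sub, ← map_sub, leibniz_lie (a i) x y, ← lie_skew y ⁅a i, x⁆]
    congr 2
    abel
  · intro x y φ ψ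
    rw [key, key]
    have h := congrArg (LinearMap.mul' k k ∘ₗ
      TensorProduct.map (ψ ∘ₗ (LieAlgebra.ad k g x)) φ) (hsym y)
    simp only [map_sum, map_add, map_zero, LinearMap.comp_apply, TensorProduct.map_tmul,
      LinearMap.mul'_apply, LieAlgebra.ad_apply, Finset.sum_add_distrib] at h
    simp only [LinearMap.comp_apply, LieAlgebra.ad_apply]
    rw [← eq_neg_iff_add_eq_zero] at h
    rw [← h]
    refine Finset.sum_congr rfl fun i _ => ?_
    rw [← lie_skew y (b i), ← lie_skew (a i) x, map_neg, map_neg]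
    ring
end
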